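/- Under the gradient descent setup (f nonnegative C² with f(x₀) > 0; 4 f(x₀) < (1−ε)² r² α(x₀,r) for some ε ∈ (0,1); L₁, L₂ bounds on first derivatives on B(x₀,r) and second derivatives on B(x₀,2r); η ≤ min{ r/(L₁√p), 2ε/(L₂ p) }; x_{j+1} := x_j − η∇f(x_j)), suppose k ≥ 1 and x₀, x₁, …, x_{k−1} ∈ B(x₀,r). Define R_j := f(x_{j+1}) − f(x_j) + η|∇f(x_j)|². Then for all 0 ≤ j ≤ k−1, |R_j| ≤ ε η |∇f(x_j)|². -/

import Mathlib

open Set Filter Metric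

/-- First-order Taylor bound on the unit interval. -/
theorem abs_sub_sub_deriv_le_of_abs_deriv_deriv_le {φ φ' φ'' : ℝ → ℝ} {C : ℝ}
    (hφ : ∀ t, HasDerivAt φ (φ' t) t) (hφ' : ∀ t, HasDerivAt φ' (φ'' t) t)
    (hC : ∀ t ∈ Icc (0 : ℝ) 1, |φ'' t| ≤ C) : |φ 1 - φ 0 - φ' 0| ≤ C / 2 := by
  have hlip : ∀ t ∈ Icc (0 : ℝ) 1, ‖φ' t - φ' 0‖ ≤ C * (t - 0) :=
    norm_image_sub_le_of_norm_deriv_le_segment'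
      (fun t _ => (hφ' t).hasDerivWithinAt) (fun t ht => hC t (Ico_subset_Icc_self ht))
  have hψ : ∀ t, HasDerivAt (fun s => φ s - φ 0 - s * φ' 0) (φ' t - φ' 0) t := fun t => by
    simpa using ((hφ t).sub_const (φ 0)).fun_sub ((hasDerivAt_id' t).mul_const (φ' 0))
  have hB : ∀ t : ℝ, HasDerivAt (fun s => C / 2 * s ^ 2) (C * t) t := fun t =>
    ((hasDerivAt_pow 2 t).const_mul (C / 2)).congr_deriv (by norm_num; ring)
  have h := image_norm_le_of_norm_deriv_right_le_deriv_boundary (a := 0) (b := 1)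
    (f := fun s => φ s - φ 0 - s * φ' 0) (f' := fun t => φ' t - φ' 0)
    (B := fun s => C / 2 * s ^ 2) (B' := fun t => C * t)
    (fun t _ => (hψ t).continuousAt.continuousWithinAt)
    (fun t _ => (hψ t).hasDerivWithinAt) (by simp) hB
    (fun t ht => by simpa using hlip t (Ico_subset_Icc_self ht))
    (right_mem_Icc.2 zero_le_one)
  simpa using h

theorem EuclideanSpace.map_eq_sum_single {p : ℕ} (A : EuclideanSpace ℝ (Fin p) →L[ℝ] ℝ)
    (v : EuclideanSpace ℝ (Fin p)) :
    A v = ∑ i, v i * A (EuclideanSpace.single i 1) := by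
  conv_lhs => rw [← (EuclideanSpace.basisFun (Fin p) ℝ).sum_repr v]
  simp [map_sum]

theorem EuclideanSpace.sq_sum_abs_le {p : ℕ} (v : EuclideanSpace ℝ (Fin p)) :
    (∑ i, |v i|) ^ 2 ≤ p * ‖v‖ ^ 2 := by
  have h := sq_sum_le_card_mul_sum_sq (s := Finset.univ) (f := fun i => |v i|)
  simpa [EuclideanSpace.norm_sq_eq] using h

/-- Bounded second partial derivatives along a segment bound the first-order Taylor remainder. -/
theorem abs_taylor_remainder_le_of_partials_le {p : ℕ} {f : EuclideanSpace ℝ (Fin p) → ℝ}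
    (hf : ContDiff ℝ 2 f) {L : ℝ} (hL0 : 0 ≤ L) (y v : EuclideanSpace ℝ (Fin p))
    (hL : ∀ t ∈ Icc (0 : ℝ) 1, ∀ i j : Fin p,
      |fderiv ℝ (fun w => fderiv ℝ f w (EuclideanSpace.single i 1)) (y + t • v)
        (EuclideanSpace.single j 1)| ≤ L) :
    |f (y + v) - f y - fderiv ℝ f y v| ≤ L * (p * ‖v‖ ^ 2) / 2 := by
  have hline : ∀ t : ℝ, HasDerivAt (fun s : ℝ => y + s • v) v t := fun t => by
    simpa using ((hasDerivAt_id t).smul_const v).const_add y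
  have hpart : ∀ i : Fin p,
      Differentiable ℝ (fun w => fderiv ℝ f w (EuclideanSpace.single i 1)) := fun i =>
    ((hf.fderiv_right (m := 1) (by norm_num)).clm_apply contDiff_const).differentiable
      (by norm_num)
  have h1 : ∀ t : ℝ, HasDerivAt (fun s : ℝ => f (y + s • v))
      (∑ i, v i * fderiv ℝ f (y + t • v) (EuclideanSpace.single i 1)) t := fun t => by
    rw [← EuclideanSpace.map_eq_sum_single]
    exact (hf.differentiable (by norm_num) _).hasFDerivAt.comp_hasDerivAt t (hline t)
  have h2 : ∀ t : ℝ, HasDerivAt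
      (fun s : ℝ => ∑ i, v i * fderiv ℝ f (y + s • v) (EuclideanSpace.single i 1))
      (∑ i, v i * ∑ j, v j * fderiv ℝ (fun w => fderiv ℝ f w (EuclideanSpace.single i 1))
        (y + t • v) (EuclideanSpace.single j 1)) t := fun t => by
    refine HasDerivAt.fun_sum fun i _ => HasDerivAt.const_mul _ ?_
    rw [← EuclideanSpace.map_eq_sum_single]
    exact (hpart i _).hasFDerivAt.comp_hasDerivAt t (hline t)
  have h := abs_sub_sub_deriv_le_of_abs_deriv_deriv_le (C := L * (p * ‖v‖ ^ 2)) h1 h2 ?_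
  · simp only [← EuclideanSpace.map_eq_sum_single] at h
    simpa using h
  intro t ht
  calc _ ≤ ∑ i, |v i| * ∑ j, |v j| * L := by
        refine (Finset.abs_sum_le_sum_abs _ _).trans (Finset.sum_le_sum fun i _ => ?_)
        rw [abs_mul]
        gcongr
        refine (Finset.abs_sum_le_sum_abs _ _).trans (Finset.sum_le_sum fun j _ => ?_)
        rw [abs_mul]
        gcongr
        exact hL t ht i j
    _ = L * (∑ i, |v i|) ^ 2 := by
        rw [← Finset.sum_mul, ← Finset.sum_mul]
        ring
    _ ≤ _ := by
        gcongr
        exact EuclideanSpace.sq_sum_abs_le v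

theorem norm_gradient_le_of_partials_le {p : ℕ} {f : EuclideanSpace ℝ (Fin p) → ℝ} {L : ℝ}
    (hL0 : 0 ≤ L) (z : EuclideanSpace ℝ (Fin p))
    (hL : ∀ i : Fin p, |fderiv ℝ f z (EuclideanSpace.single i 1)| ≤ L) :
    ‖gradient f z‖ ≤ L * √p := by
  have hcoord : ∀ i, |gradient f z i| ≤ L := fun i => by
    have h : inner ℝ (gradient f z) (EuclideanSpace.single i (1 : ℝ))
        = fderiv ℝ f z (EuclideanSpace.single i 1) := by
      simp [gradient]
    rw [EuclideanSpace.inner_single_right] at h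
    have h' : gradient f z i = fderiv ℝ f z (EuclideanSpace.single i 1) := by simpa using h
    rw [h']
    exact hL i
  refine abs_le_of_sq_le_sq' ?_ (by positivity) |>.2
  rw [EuclideanSpace.norm_sq_eq, mul_pow, Real.sq_sqrt (Nat.cast_nonneg p)]
  calc _ ≤ ∑ _i : Fin p, L ^ 2 := by
        refine Finset.sum_le_sum fun i _ => ?_
        rw [Real.norm_eq_abs]
        gcongr
        exact hcoord i
    _ = L ^ 2 * p := by simp [mul_comm]


/-- **Lemma 4.2.** In the gradient descent setup, if `x₀, …, x_{k−1} ∈ B(x₀,r)`, then with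
`R_j := f(x_{j+1}) − f(x_j) + η‖∇f(x_j)‖²`, we have `|R_j| ≤ ε η ‖∇f(x_j)‖²` for all
`0 ≤ j ≤ k−1`. -/
theorem gd_remainder_bound
    {p : ℕ} (hp : 0 < p)
    (f : EuclideanSpace ℝ (Fin p) → ℝ)
    (hf : ContDiff ℝ 2 f) (hf0 : ∀ x, 0 ≤ f x)
    (x₀ : EuclideanSpace ℝ (Fin p)) (r : ℝ) (hr : 0 < r)
    (hfx₀ : 0 < f x₀)
    (α : ℝ)
    (hα : ∀ x ∈ Metric.closedBall x₀ r, f x ≠ 0 → α * f x ≤ ‖gradient f x‖ ^ 2)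
    (ε : ℝ) (hε : ε ∈ Set.Ioo (0:ℝ) 1)
    (hmainε : 4 * f x₀ < (1 - ε) ^ 2 * r ^ 2 * α)
    (L₁ L₂ : ℝ)
    (hL₁ : ∀ z ∈ Metric.closedBall x₀ r, ∀ i : Fin p,
      |fderiv ℝ f z (EuclideanSpace.single i 1)| ≤ L₁)
    (hL₂ : ∀ z ∈ Metric.closedBall x₀ (2 * r), ∀ i j : Fin p,
      |fderiv ℝ (fun v => fderiv ℝ f v (EuclideanSpace.single i 1)) z
        (EuclideanSpace.single j 1)| ≤ L₂)
    (η : ℝ) (hη : 0 < η)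
    (hηle : η ≤ min (r / (L₁ * Real.sqrt p)) (2 * ε / (L₂ * p)))
    (x : ℕ → EuclideanSpace ℝ (Fin p)) (hx0 : x 0 = x₀)
    (hxrec : ∀ j : ℕ, x (j + 1) = x j - η • gradient f (x j))
    (k : ℕ) (hk : 1 ≤ k)
    (hball : ∀ j < k, x j ∈ Metric.closedBall x₀ r) :
    ∀ j < k,
      |f (x (j + 1)) - f (x j) + η * ‖gradient f (x j)‖ ^ 2|
        ≤ ε * η * ‖gradient f (x j)‖ ^ 2 := by
  have hp' : (0 : ℝ) < p := by exact_mod_cast hp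
  obtain ⟨hη₁, hη₂⟩ := le_min_iff.1 hηle
  have hL₁s : 0 < L₁ * √p := (div_pos_iff_of_pos_left hr).1 (hη.trans_le hη₁)
  have hL₂p : 0 < L₂ * p :=
    (div_pos_iff_of_pos_left (mul_pos two_pos hε.1)).1 (hη.trans_le hη₂)
  have hL₁0 : 0 < L₁ := pos_of_mul_pos_left hL₁s (Real.sqrt_nonneg _)
  have hL₂0 : 0 < L₂ := pos_of_mul_pos_left hL₂p hp'.le
  intro j hj
  have hxj := hball j hj
  set g := gradient f (x j) with hg
  have hgle : ‖g‖ ≤ L₁ * √p := norm_gradient_le_of_partials_le hL₁0.le _ (hL₁ _ hxj)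
  have hstep : ‖(-η) • g‖ ≤ r := by
    rw [norm_smul, norm_neg, Real.norm_of_nonneg hη.le]
    calc η * ‖g‖ ≤ η * (L₁ * √p) := by gcongr
      _ ≤ r := (le_div_iff₀ hL₁s).1 hη₁
  have hseg : ∀ t ∈ Icc (0 : ℝ) 1, x j + t • ((-η) • g) ∈ closedBall x₀ (2 * r) := by
    intro t ht
    have h : ‖t • ((-η) • g)‖ ≤ r := by
      rw [norm_smul, Real.norm_of_nonneg ht.1]
      exact (mul_le_of_le_one_left (norm_nonneg _) ht.2).trans hstep
    rw [mem_closedBall, dist_eq_norm] at hxj ⊢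
    calc _ = ‖(x j - x₀) + t • ((-η) • g)‖ := by congr 1; abel
      _ ≤ _ := (norm_add_le _ _).trans (by linarith)
  have hT := abs_taylor_remainder_le_of_partials_le hf hL₂0.le (x j) ((-η) • g)
    (fun t ht => hL₂ _ (hseg t ht))
  have hfd : fderiv ℝ f (x j) ((-η) • g) = -(η * ‖g‖ ^ 2) := by
    have h : fderiv ℝ f (x j) g = inner ℝ g g :=
      (InnerProductSpace.toDual_symm_apply (x := g) (y := fderiv ℝ f (x j))).symm
    rw [map_smul, h, real_inner_self_eq_norm_sq, smul_eq_mul, neg_mul]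
  rw [hfd, sub_neg_eq_add, norm_smul, norm_neg, Real.norm_of_nonneg hη.le, neg_smul,
    ← sub_eq_add_neg, hg, ← hxrec j] at hT
  refine hT.trans ?_
  have hη₂' : η * (L₂ * p) ≤ 2 * ε := (le_div_iff₀ hL₂p).1 hη₂
  calc _ = η * (L₂ * p) * (η * ‖g‖ ^ 2) / 2 := by ring
    _ ≤ 2 * ε * (η * ‖g‖ ^ 2) / 2 := by gcongr
    _ = _ := by ring
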